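/- (Lemma 3) Bound on the worst-case CVaR of a linear loss: Let ε ∈ (0,1), let Σ ∈ ℝ^{n×n} be symmetric positive semidefinite, and let q ∈ ℝ^n. Then WCVaR_ε[ξ ↦ qᵀξ] ≤ Σ_{i=1}^n |q_i| · WCVaR_ε[ξ ↦ ξ_i], where ξ_i denotes the i-th coordinate of ξ, and the inequality is interpreted in the extended reals. -/

import Mathlib

open MeasureTheory Matrix

/-- Conditional value-at-risk of a loss `L` at level `ε` with respect to `P`. -/
noncomputable def CVaR {n : ℕ} (ε : ℝ) (P : Measure (Fin n → ℝ)) (L : (Fin n → ℝ) → ℝ) : ℝ :=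
  ⨅ β : ℝ, (β + (1 / ε) * ∫ ξ, max (L ξ - β) 0 ∂P)

/-- The set `𝒫(Σ)` of Borel probability measures on `ℝ^n` with finite second moments,
zero mean, and second-moment matrix `Σ`. -/
def Pset (n : ℕ) (S : Matrix (Fin n) (Fin n) ℝ) : Set (Measure (Fin n → ℝ)) :=
  {P | IsProbabilityMeasure P ∧ Integrable (fun ξ => ‖ξ‖ ^ 2) P ∧
    (∀ i, ∫ ξ, ξ i ∂P = 0) ∧ ∀ i j, ∫ ξ, ξ i * ξ j ∂P = S i j}

/-- Worst-case CVaR over `𝒫(Σ)`, valued in the extended reals. -/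
noncomputable def WCVaR {n : ℕ} (ε : ℝ) (S : Matrix (Fin n) (Fin n) ℝ)
    (L : (Fin n → ℝ) → ℝ) : EReal :=
  ⨆ P ∈ Pset n S, ((CVaR ε P L : ℝ) : EReal)

section CVaRLemmas

variable {n : ℕ} {ε : ℝ} {P : Measure (Fin n → ℝ)}

lemma CVaR_le (hε : ε ∈ Set.Ioo (0 : ℝ) 1) [IsProbabilityMeasure P] {L : (Fin n → ℝ) → ℝ}
    (hL : Integrable L P) (β : ℝ) :
    CVaR ε P L ≤ β + (1 / ε) * ∫ ξ, max (L ξ - β) 0 ∂P := by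
  refine ciInf_le ⟨∫ ξ, L ξ ∂P, ?_⟩ β
  rintro _ ⟨b, rfl⟩
  have hsub : Integrable (fun ξ => L ξ - b) P := hL.sub (integrable_const b)
  have hmean : ∫ ξ, L ξ ∂P - b ≤ ∫ ξ, max (L ξ - b) 0 ∂P := by
    have hle := integral_mono hsub hsub.pos_part fun ξ => le_max_left (L ξ - b) 0
    rwa [integral_sub hL (integrable_const b), integral_const, probReal_univ, one_smul] at hle
  have hnonneg : 0 ≤ ∫ ξ, max (L ξ - b) 0 ∂P := integral_nonneg fun ξ => le_max_right _ _
  have hone : 1 ≤ 1 / ε := (one_le_div hε.1).2 hε.2.le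
  dsimp only
  nlinarith [mul_le_mul_of_nonneg_right hone hnonneg]

/-- CVaR is sublinear: subadditive and positively homogeneous. -/
lemma CVaR_sum_le (hε : ε ∈ Set.Ioo (0 : ℝ) 1) [IsProbabilityMeasure P] {ι : Type*} [Fintype ι]
    {c : ι → ℝ} (hc : ∀ i, 0 ≤ c i) {L : ι → (Fin n → ℝ) → ℝ} (hL : ∀ i, Integrable (L i) P) :
    CVaR ε P (fun ξ => ∑ i, c i * L i ξ) ≤ ∑ i, c i * CVaR ε P (L i) := by
  have hint : Integrable (fun ξ => ∑ i, c i * L i ξ) P :=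
    integrable_finsetSum _ fun i _ => (hL i).const_mul (c i)
  have hpos (i : ι) (b : ℝ) : Integrable (fun ξ => max (L i ξ - b) 0) P :=
    ((hL i).sub (integrable_const b)).pos_part
  have hbound (β : ι → ℝ) : CVaR ε P (fun ξ => ∑ i, c i * L i ξ) ≤
      ∑ i, c i * (β i + (1 / ε) * ∫ ξ, max (L i ξ - β i) 0 ∂P) := by
    have hle : ∫ ξ, max (∑ i, c i * L i ξ - ∑ i, c i * β i) 0 ∂P ≤
        ∑ i, c i * ∫ ξ, max (L i ξ - β i) 0 ∂P := by
      simp_rw [← integral_const_mul]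
      rw [← integral_finsetSum _ fun i _ => (hpos i (β i)).const_mul (c i)]
      refine integral_mono (hint.sub (integrable_const _)).pos_part
        (integrable_finsetSum _ fun i _ => (hpos i (β i)).const_mul (c i)) fun ξ => ?_
      refine max_le ?_ (Finset.sum_nonneg fun i _ => mul_nonneg (hc i) (le_max_right _ _))
      rw [← Finset.sum_sub_distrib]
      refine Finset.sum_le_sum fun i _ => ?_
      rw [← mul_sub]
      exact mul_le_mul_of_nonneg_left (le_max_left _ _) (hc i)
    calc CVaR ε P (fun ξ => ∑ i, c i * L i ξ)
        ≤ ∑ i, c i * β i + (1 / ε) * ∫ ξ, max (∑ i, c i * L i ξ - ∑ i, c i * β i) 0 ∂P :=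
          CVaR_le hε hint _
      _ ≤ ∑ i, c i * β i + (1 / ε) * ∑ i, c i * ∫ ξ, max (L i ξ - β i) 0 ∂P := by
          have := one_div_pos.2 hε.1
          gcongr
      _ = _ := by
          rw [Finset.mul_sum, ← Finset.sum_add_distrib]
          exact Finset.sum_congr rfl fun i _ => by ring
  have hc_sum : 0 ≤ ∑ i, c i := Finset.sum_nonneg fun i _ => hc i
  refine le_of_forall_pos_le_add fun η hη => ?_
  have hδ : 0 < η / (∑ i, c i + 1) := by positivity
  have hex (i : ι) : ∃ b, b + (1 / ε) * ∫ ξ, max (L i ξ - b) 0 ∂P <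
      CVaR ε P (L i) + η / (∑ i, c i + 1) := exists_lt_of_ciInf_lt (lt_add_of_pos_right _ hδ)
  choose β hβ using hex
  calc CVaR ε P (fun ξ => ∑ i, c i * L i ξ)
      ≤ ∑ i, c i * (CVaR ε P (L i) + η / (∑ i, c i + 1)) :=
        (hbound β).trans <| Finset.sum_le_sum fun i _ =>
          mul_le_mul_of_nonneg_left (hβ i).le (hc i)
    _ = ∑ i, c i * CVaR ε P (L i) + (∑ i, c i) * (η / (∑ i, c i + 1)) := by
        simp_rw [mul_add, Finset.sum_add_distrib, Finset.sum_mul]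
    _ ≤ _ := by
        gcongr
        rw [← mul_div_assoc, div_le_iff₀ (by positivity)]
        nlinarith

lemma CVaR_map_neg (i : Fin n) :
    CVaR ε (P.map Neg.neg) (fun ξ => ξ i) = CVaR ε P (fun ξ => -ξ i) := by
  unfold CVaR
  congr! 4 with β
  exact (MeasurableEquiv.neg (Fin n → ℝ)).measurableEmbedding.integral_map _

lemma map_neg_mem_Pset {S : Matrix (Fin n) (Fin n) ℝ} (hP : P ∈ Pset n S) :
    P.map Neg.neg ∈ Pset n S := by
  obtain ⟨hprob, hsq, hmean, hcov⟩ := hP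
  have hemb : MeasurableEmbedding (Neg.neg : (Fin n → ℝ) → Fin n → ℝ) :=
    (MeasurableEquiv.neg (Fin n → ℝ)).measurableEmbedding
  refine ⟨Measure.isProbabilityMeasure_map measurable_neg.aemeasurable, ?_, fun i => ?_,
    fun i j => ?_⟩
  · rw [hemb.integrable_map_iff]
    simpa [Function.comp_def] using hsq
  · rw [hemb.integral_map]
    simp [integral_neg, hmean i]
  · rw [hemb.integral_map]
    simpa using hcov i j

lemma integrable_eval_of_mem_Pset {S : Matrix (Fin n) (Fin n) ℝ} (hP : P ∈ Pset n S)
    (i : Fin n) : Integrable (fun ξ => ξ i) P := by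
  obtain ⟨hprob, hsq, -, -⟩ := hP
  refine ((integrable_const (1 : ℝ)).add hsq).mono' (measurable_pi_apply i).aestronglyMeasurable
    (ae_of_all _ fun ξ => ?_)
  have := norm_le_pi_norm ξ i
  simp only [Pi.add_apply]
  nlinarith [sq_nonneg (‖ξ‖ - 1), norm_nonneg ξ]

lemma CVaR_sign_le_WCVaR {S : Matrix (Fin n) (Fin n) ℝ} (hP : P ∈ Pset n S) (a : ℝ) (i : Fin n) :
    ((|a| * CVaR ε P (fun ξ => SignType.sign a * ξ i) : ℝ) : EReal) ≤
      ((|a| : ℝ) : EReal) * WCVaR ε S (fun ξ => ξ i) := by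
  rw [EReal.coe_mul]
  rcases lt_trichotomy a 0 with ha | rfl | ha
  · refine mul_le_mul_of_nonneg_left ?_ (EReal.coe_nonneg.2 (abs_nonneg a))
    simp only [sign_neg ha, SignType.coe_neg_one, neg_one_mul, ← CVaR_map_neg]
    exact le_iSup₂_of_le (P.map Neg.neg) (map_neg_mem_Pset hP) le_rfl
  · simp
  · refine mul_le_mul_of_nonneg_left ?_ (EReal.coe_nonneg.2 (abs_nonneg a))
    simp only [sign_pos ha, SignType.coe_one, one_mul]
    exact le_iSup₂_of_le P hP le_rfl

end CVaRLemmas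

/-- (Lemma 3) Bound on the worst-case CVaR of a linear loss. -/
theorem wcvar_linear_bound {n : ℕ} (ε : ℝ) (hε : ε ∈ Set.Ioo (0 : ℝ) 1)
    (S : Matrix (Fin n) (Fin n) ℝ) (hS : S.PosSemidef) (q : Fin n → ℝ) :
    WCVaR ε S (fun ξ => q ⬝ᵥ ξ) ≤
      ∑ i : Fin n, ((|q i| : ℝ) : EReal) * WCVaR ε S (fun ξ => ξ i) := by
  refine iSup₂_le fun P hP => ?_
  have : IsProbabilityMeasure P := hP.1
  have hdot : (fun ξ : Fin n → ℝ => q ⬝ᵥ ξ) =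
      fun ξ => ∑ i, |q i| * (SignType.sign (q i) * ξ i) := by
    ext ξ
    simp_rw [dotProduct, ← mul_assoc, abs_mul_sign]
  calc ((CVaR ε P (fun ξ => q ⬝ᵥ ξ) : ℝ) : EReal)
      ≤ ((∑ i, |q i| * CVaR ε P (fun ξ => SignType.sign (q i) * ξ i) : ℝ) : EReal) := by
        rw [hdot, EReal.coe_le_coe_iff]
        exact CVaR_sum_le hε (fun i => abs_nonneg (q i)) fun i =>
          (integrable_eval_of_mem_Pset hP i).const_mul _
    _ = ∑ i, ((|q i| * CVaR ε P (fun ξ => SignType.sign (q i) * ξ i) : ℝ) : EReal) :=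
        map_sum (⟨⟨Real.toEReal, EReal.coe_zero⟩, EReal.coe_add⟩ : ℝ →+ EReal) _ _
    _ ≤ _ := Finset.sum_le_sum fun i _ => CVaR_sign_le_WCVaR hP (q i) i
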